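/- Strong duality for the channel-optimization SDP: for any positive semidefinite operator W on a finite-dimensional bipartite Hilbert space H_A ⊗ H_B, the maximum of Tr[W J] over all positive semidefinite J on H_A ⊗ H_B with partial trace Tr_B J = 1_A equals the minimum of Tr[X] over Hermitian operators X on H_A satisfying X ⊗ 1_B ≥ W. -/

import Mathlib

open scoped Kronecker ComplexOrder

/-- Partial trace over the second tensor factor. -/
noncomputable def ptraceB {A B : Type*} [Fintype B]
    (M : Matrix (A × B) (A × B) ℂ) : Matrix A A ℂ :=
  Matrix.of fun a a' => ∑ b : B, M (a, b) (a', b)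

/-- Primal feasibility: `J` is the Choi matrix of a CPTP map, i.e. `J ≥ 0`
and `Tr_B J = 1_A`. -/
def PrimalFeasible {A B : Type*} [Fintype A] [Fintype B] [DecidableEq A]
    (J : Matrix (A × B) (A × B) ℂ) : Prop :=
  J.PosSemidef ∧ ptraceB J = 1

/-- Dual feasibility: `X` is Hermitian on `H_A` with `X ⊗ 1_B ≥ W`. -/
def DualFeasible {A B : Type*} [Fintype A] [Fintype B] [DecidableEq A]
    [DecidableEq B] (W : Matrix (A × B) (A × B) ℂ) (X : Matrix A A ℂ) : Prop :=
  X.IsHermitian ∧ (X ⊗ₖ (1 : Matrix B B ℂ) - W).PosSemidef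


lemma aux_factor {n : Type*} [Fintype n] [DecidableEq n] {J : Matrix n n ℂ} (hJ : J.PosSemidef) :
    ∃ C : Matrix n n ℂ, J = C.conjTranspose * C := by
  open scoped MatrixOrder Matrix.Norms.L2Operator in
  exact CStarAlgebra.nonneg_iff_eq_star_mul_self.mp (Matrix.nonneg_iff_posSemidef.mpr hJ)

lemma aux_shift {n : Type*} [Fintype n] [DecidableEq n] {H : Matrix n n ℂ} (hH : H.IsHermitian) :
    ∃ a : ℝ, (a • (1 : Matrix n n ℂ) + H).PosSemidef := by
  open scoped MatrixOrder Matrix.Norms.L2Operator in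
  have h := IsSelfAdjoint.neg_algebraMap_norm_le_self (A := Matrix n n ℂ) (a := H) hH
  refine ⟨‖H‖, ?_⟩
  rw [Matrix.le_iff, sub_neg_eq_add, Algebra.algebraMap_eq_smul_one, add_comm] at h
  exact h

lemma aux_trace_mul {n : Type*} [Fintype n] [DecidableEq n] {P J : Matrix n n ℂ}
    (hP : P.PosSemidef) (hJ : J.PosSemidef) : 0 ≤ (P * J).trace := by
  obtain ⟨C, rfl⟩ := aux_factor hJ
  rw [← Matrix.mul_assoc, Matrix.trace_mul_comm, ← Matrix.mul_assoc]
  exact (hP.mul_mul_conjTranspose_same C).trace_nonneg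

section
set_option linter.unusedSectionVars false
variable {A B : Type*} [Fintype A] [Fintype B] [DecidableEq A] [DecidableEq B]

lemma aux_pt_trace (J : Matrix (A × B) (A × B) ℂ) : (ptraceB J).trace = J.trace := by
  simp [ptraceB, Matrix.trace, Fintype.sum_prod_type]

lemma aux_pt_mul (X : Matrix A A ℂ) (J : Matrix (A × B) (A × B) ℂ) :
    ((X ⊗ₖ (1 : Matrix B B ℂ)) * J).trace = (X * ptraceB J).trace := by
  simp only [ptraceB, Matrix.trace, Fintype.sum_prod_type, Matrix.mul_apply, Matrix.diag_apply,
    Matrix.kroneckerMap_apply, Matrix.one_apply, Matrix.of_apply, Finset.mul_sum]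
  simp only [mul_ite, mul_one, mul_zero, ite_mul, zero_mul, Finset.sum_ite_eq, Finset.mem_univ,
    if_true]
  exact Finset.sum_congr rfl fun a _ => Finset.sum_comm

lemma aux_pt_add (J K : Matrix (A × B) (A × B) ℂ) : ptraceB (J + K) = ptraceB J + ptraceB K := by
  ext; simp [ptraceB, Finset.sum_add_distrib]

lemma aux_pt_smul (c : ℝ) (J : Matrix (A × B) (A × B) ℂ) : ptraceB (c • J) = c • ptraceB J := by
  ext; simp [ptraceB, Finset.mul_sum]

lemma aux_pt_kron (Y : Matrix A A ℂ) (b : B) :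
    ptraceB (Y ⊗ₖ (Matrix.single b b (1 : ℂ))) = Y := by
  ext; simp [ptraceB, Matrix.single_apply]

lemma aux_single_psd (b : B) : (Matrix.single b b (1 : ℂ)).PosSemidef := by
  rw [← Matrix.diagonal_single]
  refine Matrix.PosSemidef.diagonal ?_
  exact Pi.single_nonneg.mpr zero_le_one

lemma aux_smul_psd {n : Type*} [Fintype n] {J : Matrix n n ℂ} (hJ : J.PosSemidef) {c : ℝ}
    (hc : 0 ≤ c) : (c • J).PosSemidef := hJ.smul hc

lemma aux_pt_herm {J : Matrix (A × B) (A × B) ℂ} (hJ : J.IsHermitian) :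
    (ptraceB J).IsHermitian := by
  ext i j
  simp only [ptraceB, Matrix.conjTranspose_apply, Matrix.of_apply, star_sum]
  exact Finset.sum_congr rfl fun b _ => hJ.apply _ _

lemma aux_primal [Nonempty B] (W : Matrix (A × B) (A × B) ℂ) :
    ∃ J, PrimalFeasible J ∧ ∀ J', PrimalFeasible J' → (W * J').trace.re ≤ (W * J).trace.re := by
  classical
  let S : Set (Matrix (A × B) (A × B) ℂ) := {C | ptraceB (C.conjTranspose * C) = 1}
  have hcont : Continuous fun C : Matrix (A × B) (A × B) ℂ => C.conjTranspose * C :=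
    (continuous_id.matrix_conjTranspose).matrix_mul continuous_id
  have hclosed : IsClosed S := by
    refine isClosed_eq ?_ continuous_const
    refine continuous_matrix fun a a' => ?_
    simp only [ptraceB, Matrix.of_apply]
    exact continuous_finsetSum _ fun b _ => hcont.matrix_elem _ _
  let R : ℝ := Fintype.card A + 1
  have hK : IsCompact (Set.pi Set.univ fun _ : A × B => Set.pi Set.univ fun _ : A × B =>
      Metric.closedBall (0 : ℂ) R) :=
    isCompact_univ_pi fun _ => isCompact_univ_pi fun _ => isCompact_closedBall _ _
  have hsub : S ⊆ (Set.pi Set.univ fun _ : A × B => Set.pi Set.univ fun _ : A × B =>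
      Metric.closedBall (0 : ℂ) R) := by
    intro C hC i _ j _
    have h1 : (C.conjTranspose * C).trace = Fintype.card A := by
      rw [← aux_pt_trace, show ptraceB (C.conjTranspose * C) = 1 from hC, Matrix.trace_one]
    have h2 : ∑ j, ∑ i, ‖C i j‖ ^ 2 = (Fintype.card A : ℝ) := by
      have := congrArg Complex.re h1
      simpa [Matrix.trace, Matrix.mul_apply, Complex.sq_norm, Complex.normSq_apply] using this
    have h3 : ‖C i j‖ ^ 2 ≤ Fintype.card A := by
      rw [← h2]
      refine le_trans ?_ (Finset.single_le_sum (f := fun j => ∑ i, ‖C i j‖ ^ 2)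
        (fun j _ => Finset.sum_nonneg fun i _ => sq_nonneg _) (Finset.mem_univ j))
      exact Finset.single_le_sum (f := fun i => ‖C i j‖ ^ 2)
        (fun i _ => sq_nonneg _) (Finset.mem_univ i)
    rw [mem_closedBall_zero_iff]
    show ‖C i j‖ ≤ (Fintype.card A : ℝ) + 1
    nlinarith [norm_nonneg (C i j), sq_nonneg (‖C i j‖ - 1)]
  have hS : IsCompact S := hK.of_isClosed_subset hclosed hsub
  have hne : S.Nonempty := by
    obtain ⟨b⟩ := ‹Nonempty B›
    obtain ⟨C, hC⟩ := aux_factor ((Matrix.PosSemidef.one (n := A) (R := ℂ)).kronecker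
      (aux_single_psd b))
    refine ⟨C, ?_⟩
    show ptraceB (C.conjTranspose * C) = 1
    rw [← hC, aux_pt_kron]
  obtain ⟨C, hC, hmax⟩ := hS.exists_isMaxOn hne
    (f := fun C => (W * (C.conjTranspose * C)).trace.re)
    (Complex.continuous_re.comp ((continuous_const.matrix_mul hcont).matrix_trace)).continuousOn
  refine ⟨C.conjTranspose * C, ⟨Matrix.posSemidef_conjTranspose_mul_self C, hC⟩, ?_⟩
  rintro J' ⟨h1, h2⟩
  obtain ⟨C', rfl⟩ := aux_factor h1
  exact hmax h2

/-- Every real functional on complex matrices is the real part of a trace pairing. -/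
lemma aux_repr (φ : Matrix A A ℂ →ₗ[ℝ] ℝ) :
    ∃ X : Matrix A A ℂ, ∀ Y, φ Y = (X * Y).trace.re := by
  refine ⟨Matrix.of fun j i => ((φ (Matrix.single i j 1) : ℝ) : ℂ)
    - Complex.I * ((φ (Matrix.single i j Complex.I) : ℝ) : ℂ), fun Y => ?_⟩
  have hY : Y = ∑ i, ∑ j, ((Y i j).re • Matrix.single i j (1 : ℂ)
      + (Y i j).im • Matrix.single i j Complex.I) := by
    conv_lhs => rw [Matrix.matrix_eq_sum_single Y]
    refine Finset.sum_congr rfl fun i _ => Finset.sum_congr rfl fun j _ => ?_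
    rw [Matrix.smul_single, Matrix.smul_single, ← Matrix.single_add]
    congr 1
    apply Complex.ext <;> simp
  conv_lhs => rw [hY]
  simp only [map_sum, map_add, map_smul, Matrix.trace, Matrix.diag_apply, Matrix.mul_apply,
    Matrix.of_apply, Complex.re_sum]
  rw [Finset.sum_comm]
  refine Finset.sum_congr rfl fun i _ => Finset.sum_congr rfl fun j _ => ?_
  simp
  ring

/-- The cone used in the Riesz extension argument. -/
def auxCone (W : Matrix (A × B) (A × B) ℂ) : PointedCone ℝ (Matrix A A ℂ × ℝ) where
  carrier := {z | ∃ J : Matrix (A × B) (A × B) ℂ, J.PosSemidef ∧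
    ptraceB J + ptraceB J = z.1 + z.1.conjTranspose ∧ - (W * J).trace.re ≤ z.2}
  zero_mem' := ⟨0, Matrix.PosSemidef.zero, by ext; simp [ptraceB], by simp⟩
  add_mem' := by
    rintro x y ⟨J, hJ, h1, h2⟩ ⟨K, hK, k1, k2⟩
    refine ⟨J + K, hJ.add hK, ?_, ?_⟩
    · rw [aux_pt_add, add_add_add_comm, h1, k1, Prod.fst_add, Matrix.conjTranspose_add,
        add_add_add_comm]
    · simp only [Matrix.mul_add, Matrix.trace_add, Complex.add_re, Prod.snd_add]
      linarith
  smul_mem' := by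
    rintro ⟨c, hc⟩ x ⟨J, hJ, h1, h2⟩
    refine ⟨c • J, aux_smul_psd hJ hc, ?_, ?_⟩
    · show _ = c • x.1 + (c • x.1).conjTranspose
      rw [aux_pt_smul, Matrix.conjTranspose_smul, ← smul_add, h1, smul_add]
      simp
    · show _ ≤ c * x.2
      simp only [Matrix.mul_smul, Matrix.trace_smul, Complex.smul_re, smul_eq_mul]
      nlinarith

lemma aux_bound {W : Matrix (A × B) (A × B) ℂ} [Nonempty A] {p : ℝ}
    (hp : ∀ J', PrimalFeasible J' → (W * J').trace.re ≤ p) {J : Matrix (A × B) (A × B) ℂ}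
    (hJ : J.PosSemidef) {a : ℝ} (h : ptraceB J = a • 1) : (W * J).trace.re ≤ p * a := by
  have ht : J.trace = a * Fintype.card A := by
    rw [← aux_pt_trace, h, Matrix.trace_smul, Matrix.trace_one]; simp
  have hc : (0 : ℝ) < Fintype.card A := by exact_mod_cast Fintype.card_pos
  have ha : 0 ≤ a := by
    have h0 := (Complex.le_def.mp hJ.trace_nonneg).1
    rw [ht] at h0
    simp at h0
    exact le_of_mul_le_mul_right (by simpa using h0) hc
  rcases ha.eq_or_lt with rfl | ha
  · have : J = 0 := hJ.trace_eq_zero_iff.mp (by simp [ht])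
    simp [this]
  · have := hp (a⁻¹ • J) ⟨aux_smul_psd hJ (by positivity), by
      rw [aux_pt_smul, h, smul_smul, inv_mul_cancel₀ ha.ne', one_smul]⟩
    simp only [Matrix.mul_smul, Matrix.trace_smul, Complex.smul_re, smul_eq_mul] at this
    rwa [inv_mul_le_iff₀ ha, mul_comm] at this

lemma aux_functional [Nonempty A] [Nonempty B] {W : Matrix (A × B) (A × B) ℂ} {p : ℝ}
    (hp : ∀ J', PrimalFeasible J' → (W * J').trace.re ≤ p) :
    ∃ φ : Matrix A A ℂ →ₗ[ℝ] ℝ, φ 1 = p ∧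
      ∀ J : Matrix (A × B) (A × B) ℂ, J.PosSemidef → (W * J).trace.re ≤ φ (ptraceB J) := by
  obtain ⟨i0⟩ := id ‹Nonempty A›
  obtain ⟨b0⟩ := id ‹Nonempty B›
  let F : Matrix A A ℂ × ℝ →ₗ[ℝ] ℝ :=
    { toFun := fun z => p * (z.1 i0 i0).re + z.2
      map_add' := by intro x y; simp; ring
      map_smul' := by intro c x; simp; ring }
  have hF : ∀ z, F z = p * (z.1 i0 i0).re + z.2 := fun _ => rfl
  let D : Submodule ℝ (Matrix A A ℂ × ℝ) := (Submodule.span ℝ {(1 : Matrix A A ℂ)}).prod ⊤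
  have hD : ∀ (a t : ℝ), ((a • 1, t) : Matrix A A ℂ × ℝ) ∈ D := fun a t =>
    ⟨Submodule.smul_mem _ _ (Submodule.mem_span_singleton_self _), trivial⟩
  obtain ⟨g, hg1, hg2⟩ := riesz_extension (auxCone W) (F.toPMap D) (by
      rintro ⟨⟨Y, t⟩, hY, hT⟩ ⟨J, hJ, h1, h2⟩
      obtain ⟨a, ha⟩ := Submodule.mem_span_singleton.mp hY
      dsimp only at ha h1 h2
      subst ha
      show 0 ≤ p * (((a • 1 : Matrix A A ℂ)) i0 i0).re + t
      have h3 : ptraceB J = a • 1 := by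
        rw [Matrix.conjTranspose_smul, Matrix.conjTranspose_one, star_trivial, ← two_smul ℝ,
          ← two_smul ℝ] at h1
        exact smul_right_injective _ (two_ne_zero' ℝ) h1
      have := aux_bound hp hJ h3
      simp
      linarith) (by
      rintro ⟨Y, t⟩
      have hH : ((1 / 2 : ℝ) • (Y + Y.conjTranspose)).IsHermitian := by
        simp [Matrix.IsHermitian, add_comm]
      obtain ⟨a, ha⟩ := aux_shift hH
      let J := (a • 1 + (1 / 2 : ℝ) • (Y + Y.conjTranspose)) ⊗ₖ (Matrix.single b0 b0 (1 : ℂ))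
      refine ⟨⟨(a • 1, - (W * J).trace.re - t), hD _ _⟩, J, ha.kronecker (aux_single_psd b0),
        ?_, ?_⟩
      · simp only [J, aux_pt_kron, Prod.fst_add, Matrix.conjTranspose_add,
          Matrix.conjTranspose_smul, Matrix.conjTranspose_one, star_trivial]
        module
      · simp)
  refine ⟨g.comp (LinearMap.inl ℝ _ _), ?_, ?_⟩
  · have := hg1 ⟨_, hD 1 0⟩
    change g _ = F _ at this
    rw [hF] at this
    simpa using this
  · intro J hJ
    have h0 := hg2 (ptraceB J, - (W * J).trace.re)
      ⟨J, hJ, by rw [(aux_pt_herm hJ.1).eq], le_rfl⟩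
    have h1 := hg1 ⟨_, hD 0 1⟩
    change g _ = F _ at h1
    rw [hF] at h1
    have h2 : ((ptraceB J, - (W * J).trace.re) : Matrix A A ℂ × ℝ)
        = (ptraceB J, 0) + (- (W * J).trace.re) • ((0 : ℝ) • 1, 1) := by simp
    rw [h2, map_add, map_smul, h1] at h0
    simp at h0
    simpa using h0

lemma aux_weak {W : Matrix (A × B) (A × B) ℂ} {J X} (hJ : PrimalFeasible J)
    (hX : DualFeasible W X) : (W * J).trace ≤ X.trace := by
  have := aux_trace_mul hX.2 hJ.1
  rw [Matrix.sub_mul, Matrix.trace_sub, aux_pt_mul, hJ.2, Matrix.mul_one] at this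
  exact sub_nonneg.mp this

lemma aux_real {n : Type*} [Fintype n] {X : Matrix n n ℂ} (hX : X.IsHermitian) :
    X.trace.im = 0 := by
  rw [← Complex.conj_eq_iff_im, ← hX.eq]
  exact (Matrix.trace_conjTranspose _).symm.trans (by rw [Matrix.conjTranspose_conjTranspose, hX.eq])

lemma aux_dual [Nonempty A] [Nonempty B] {W : Matrix (A × B) (A × B) ℂ} (hW : W.IsHermitian)
    {p : ℝ} (hp : ∀ J', PrimalFeasible J' → (W * J').trace.re ≤ p) :
    ∃ X, DualFeasible W X ∧ X.trace.re = p := by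
  obtain ⟨φ, h1, h2⟩ := aux_functional hp
  obtain ⟨X, hX⟩ := aux_repr φ
  let Z : Matrix A A ℂ := (1 / 2 : ℝ) • (X + X.conjTranspose)
  have hZ : Z.IsHermitian := by simp [Z, Matrix.IsHermitian, add_comm]
  have hZt : ∀ Y : Matrix A A ℂ, Y.IsHermitian → (Z * Y).trace.re = φ Y := by
    intro Y hY
    have h : (X.conjTranspose * Y).trace.re = (X * Y).trace.re := by
      conv_lhs => rw [← hY.eq, ← Matrix.conjTranspose_mul, Matrix.trace_conjTranspose,
        Matrix.trace_mul_comm]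
      simp
    simp only [Z, Matrix.smul_mul, Matrix.add_mul, Matrix.trace_smul, Matrix.trace_add,
      Complex.smul_re, Complex.add_re, h, hX, smul_eq_mul]
    ring
  have hH : (Z ⊗ₖ (1 : Matrix B B ℂ) - W).IsHermitian := by
    refine Matrix.IsHermitian.sub ?_ hW
    rw [Matrix.IsHermitian, Matrix.conjTranspose_kronecker, hZ.eq, Matrix.conjTranspose_one]
  refine ⟨Z, ⟨hZ, Matrix.PosSemidef.of_dotProduct_mulVec_nonneg hH fun v => ?_⟩, ?_⟩
  · have hJ := Matrix.posSemidef_vecMulVec_self_star v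
    have h3 := h2 _ hJ
    rw [← hZt _ (aux_pt_herm hJ.1), ← aux_pt_mul] at h3
    have h4 : star v ⬝ᵥ ((Z ⊗ₖ (1 : Matrix B B ℂ) - W).mulVec v)
        = ((Z ⊗ₖ (1 : Matrix B B ℂ) - W) * Matrix.vecMulVec v (star v)).trace := by
      rw [Matrix.mul_vecMulVec, Matrix.trace_vecMulVec, dotProduct_comm]
    refine Complex.le_def.mpr ⟨?_, ?_⟩
    · rw [h4, Matrix.sub_mul, Matrix.trace_sub, Complex.sub_re, Complex.zero_re]
      linarith
    · exact (hH.im_star_dotProduct_mulVec_self v).symm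
  · rw [← h1, ← hZt 1 Matrix.isHermitian_one, Matrix.mul_one]

end

/-- strong duality for the channel-optimization SDP.  For any
`W ≥ 0` on `H_A ⊗ H_B` there are an optimal primal solution `J` and an optimal
dual solution `X` with equal values: the maximum of `Tr[W J]` over Choi
matrices equals the minimum of `Tr[X]` over Hermitian `X` with
`X ⊗ 1_B ≥ W`. -/
theorem sdp_strong_duality {A B : Type*} [Fintype A] [Fintype B]
    [DecidableEq A] [DecidableEq B] [Nonempty A] [Nonempty B]
    (W : Matrix (A × B) (A × B) ℂ) (hW : W.PosSemidef) :
    ∃ (J : Matrix (A × B) (A × B) ℂ) (X : Matrix A A ℂ),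
      PrimalFeasible J ∧ DualFeasible W X ∧
      (W * J).trace = X.trace ∧
      (∀ J', PrimalFeasible J' → (W * J').trace ≤ (W * J).trace) ∧
      (∀ X', DualFeasible W X' → X.trace ≤ X'.trace) := by
  obtain ⟨J, hJ, hmax⟩ := aux_primal W
  obtain ⟨X, hX, hXp⟩ := aux_dual hW.1 hmax
  have heq : (W * J).trace = X.trace := by
    refine Complex.ext hXp.symm ?_
    exact (Complex.le_def.mp (aux_weak hJ hX)).2
  exact ⟨J, X, hJ, hX, heq, fun J' hJ' => heq ▸ aux_weak hJ' hX,
    fun X' hX' => heq ▸ aux_weak hJ hX'⟩
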